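/- Let a > 1/2, let (q_n) be any sequence with q_n ∈ [a, 1) for all n (a time-varying observation model that is uniformly accurate), let p₀ ∈ (0,1), and define p_{n+1} = p_n*q_n / (p_n*q_n + (1-p_n)*(1-q_n)). Then p_n → 1 as n → ∞. -/

import Mathlib

/-- A Bayesian update keeps the belief in `(0, 1)`. -/
theorem bayes_update_mem_Ioo {p q : ℝ} (hp : p ∈ Set.Ioo 0 1) (hq : q ∈ Set.Ioo 0 1) :
    p * q / (p * q + (1 - p) * (1 - q)) ∈ Set.Ioo 0 1 := by
  have h₁ : 0 < p * q := mul_pos hp.1 hq.1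
  have h₂ : 0 < (1 - p) * (1 - q) := mul_pos (sub_pos.2 hp.2) (sub_pos.2 hq.2)
  exact ⟨by positivity, (div_lt_one (by positivity)).2 (by linarith)⟩

/-- A Bayesian update multiplies the odds against the proposition by `(1 - q) / q`. -/
theorem bayes_update_odds {p q : ℝ} (hp : p ∈ Set.Ioo 0 1) (hq : q ∈ Set.Ioo 0 1) :
    (1 - p * q / (p * q + (1 - p) * (1 - q))) / (p * q / (p * q + (1 - p) * (1 - q))) =
      (1 - p) / p * ((1 - q) / q) := by
  have hp0 : p ≠ 0 := hp.1.ne'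
  have hq0 : q ≠ 0 := hq.1.ne'
  have h₁ : 0 < p * q := mul_pos hp.1 hq.1
  have h₂ : 0 < (1 - p) * (1 - q) := mul_pos (sub_pos.2 hp.2) (sub_pos.2 hq.2)
  have hD : p * q + (1 - p) * (1 - q) ≠ 0 := by positivity
  rw [one_sub_div hD, div_div_div_cancel_right₀ hD, add_sub_cancel_left, div_mul_div_comm]

/-- Time-varying observation models that are uniformly accurate (`q_n ∈ [a, 1)` with
`a > 1/2`) drive the belief to `1` under repeated Bayesian updates. -/
theorem bayes_iterate_time_varying_tendsto_one (a p₀ : ℝ) (ha : 1 / 2 < a)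
    (q : ℕ → ℝ) (hq : ∀ n, a ≤ q n ∧ q n < 1)
    (hp0 : 0 < p₀) (hp1 : p₀ < 1) (p : ℕ → ℝ) (h0 : p 0 = p₀)
    (hrec : ∀ n, p (n + 1) = p n * q n / (p n * q n + (1 - p n) * (1 - q n))) :
    Filter.Tendsto p Filter.atTop (nhds 1) := by
  have ha0 : 0 < a := by linarith
  have hq01 (n : ℕ) : q n ∈ Set.Ioo 0 1 := ⟨ha0.trans_le (hq n).1, (hq n).2⟩
  have hp (n : ℕ) : p n ∈ Set.Ioo 0 1 := by
    induction n with
    | zero => exact h0 ▸ ⟨hp0, hp1⟩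
    | succ n ih => exact hrec n ▸ bayes_update_mem_Ioo ih (hq01 n)
  have ha1 : a < 1 := (hq 0).1.trans_lt (hq 0).2
  have hr0 : 0 ≤ (1 - a) / a := div_nonneg (by linarith) ha0.le
  have hr1 : (1 - a) / a < 1 := (div_lt_one ha0).2 (by linarith)
  have hodds (n : ℕ) : (1 - p n) / p n ≤ (1 - p₀) / p₀ * ((1 - a) / a) ^ n := by
    induction n with
    | zero => simp [h0]
    | succ n ih =>
      rw [hrec, bayes_update_odds (hp n) (hq01 n), pow_succ, ← mul_assoc]
      have hqr : (1 - q n) / q n ≤ (1 - a) / a :=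
        div_le_div₀ (by linarith) (by linarith [(hq n).1]) ha0 (hq n).1
      exact mul_le_mul ih hqr (div_nonneg (sub_nonneg.2 (hq n).2.le) (hq01 n).1.le)
        (mul_nonneg (div_nonneg (by linarith) hp0.le) (pow_nonneg hr0 n))
  have hlim : Filter.Tendsto (fun n : ℕ ↦ 1 - (1 - p₀) / p₀ * ((1 - a) / a) ^ n)
      Filter.atTop (nhds 1) := by
    simpa using ((tendsto_pow_atTop_nhds_zero_of_lt_one hr0 hr1).const_mul
      ((1 - p₀) / p₀)).const_sub 1
  refine tendsto_of_tendsto_of_tendsto_of_le_of_le hlim tendsto_const_nhds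
    (fun n ↦ ?_) (fun n ↦ (hp n).2.le)
  have := (le_div_self (sub_nonneg.2 (hp n).2.le) (hp n).1 (hp n).2.le).trans (hodds n)
  dsimp only
  linarith
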